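/- arXiv:2203.03566 — 2 statements merged into one kernel-verified Lean document; each statement's English description precedes it below -/
import Mathlib

section
/- Let L > 0 and 0 < m < M, and let q : [0,L] → ℝ be continuously differentiable with q'(x) < 0 for all x ∈ [0,L], q(0) = M and q(L) = m, with inverse function q⁻¹ : [m,M] → [0,L]. Define u(y) = (y/(πL)) ∫₀^{q⁻¹(y)} (q(x)² − y²)^{−1/2} dx for y ∈ (m,M), and s(t) = √(t² − m²) for t ≥ m. Then all the (improper) integrals below converge and, for every ξ ∈ (m,M), ∫_m^M [ log((y+ξ)/|y−ξ|) + log( (s(ξ)s(y) + ξy − m²) / (s(ξ)s(y) + ξy + m²) ) ] · u(y) dy + (1/L) ∫_{q⁻¹(ξ)}^L (ξ² − q(x)²)^{1/2} dx = s(ξ). -/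
open MeasureTheory Set

/-- A nonnegative derivative of a continuous function is integrable, and the fundamental theorem
of calculus holds for it. -/
lemma integrable_and_integral_eq_sub_of_hasDerivAt_of_nonneg {a b : ℝ} (hab : a ≤ b) {F f : ℝ → ℝ}
    (hF : ContinuousOn F (Icc a b)) (hd : ∀ x ∈ Ioo a b, HasDerivAt F (f x) x)
    (hf : ∀ x ∈ Ioo a b, 0 ≤ f x) :
    IntervalIntegrable f volume a b ∧ ∫ x in a..b, f x = F b - F a := by
  have hi : IntervalIntegrable f volume a b :=
    (intervalIntegrable_iff_integrableOn_Ioc_of_le hab).2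
      (intervalIntegral.integrableOn_deriv_of_nonneg hF hd hf)
  exact ⟨hi, intervalIntegral.integral_eq_sub_of_hasDerivAt_of_le hab hF hd hi⟩

lemma hasDerivAt_sqrt_sq_sub_sq {p t : ℝ} (h : 0 < p ^ 2 - t ^ 2) :
    HasDerivAt (fun t => √(p ^ 2 - t ^ 2)) (-t / √(p ^ 2 - t ^ 2)) t := by
  have h1 : HasDerivAt (fun t => p ^ 2 - t ^ 2) (-(2 * t)) t := by
    simpa using ((hasDerivAt_id t).pow 2).const_sub (p ^ 2)
  convert h1.sqrt h.ne' using 1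
  have := (Real.sqrt_pos.2 h).ne'
  field_simp

lemma hasDerivAt_arcsin_div {p t : ℝ} (h0 : 0 < t) (hp : t < p) :
    HasDerivAt (fun t => Real.arcsin (t / p)) (1 / √(p ^ 2 - t ^ 2)) t := by
  have hp0 : 0 < p := h0.trans hp
  have h1 : t / p < 1 := (div_lt_one hp0).2 hp
  have h2 : 0 < t / p := by positivity
  have h3 : HasDerivAt (fun t => t / p) (1 / p) t := (hasDerivAt_id t).div_const p
  refine ((Real.hasDerivAt_arcsin (by linarith) h1.ne).comp t h3).congr_deriv ?_
  have h4 : 1 - (t / p) ^ 2 = (p ^ 2 - t ^ 2) / p ^ 2 := by field_simp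
  have h5 : 0 < √(p ^ 2 - t ^ 2) := Real.sqrt_pos.2 (by nlinarith)
  rw [h4, Real.sqrt_div (by nlinarith), Real.sqrt_sq hp0.le]
  field_simp

/-- Antiderivative of `t * log |(σ + t) / (σ - t)| / √(p² - t²)` when `σ < p`. -/
noncomputable def primLt (σ p t : ℝ) : ℝ :=
  (√(p ^ 2 - t ^ 2) - √(p ^ 2 - σ ^ 2)) * Real.log (σ - t)
    - (√(p ^ 2 - t ^ 2) + √(p ^ 2 - σ ^ 2)) * Real.log (σ + t)
    + 2 * σ * Real.arcsin (t / p)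
    + 2 * √(p ^ 2 - σ ^ 2) * Real.log (σ * √(p ^ 2 - t ^ 2) + √(p ^ 2 - σ ^ 2) * t)

lemma hasDerivAt_primLt {σ p t : ℝ} (hσ : 0 < σ) (hσp : σ < p) (h0 : 0 < t) (hp : t < p)
    (hne : t ≠ σ) :
    HasDerivAt (primLt σ p) (Real.log ((σ + t) / |t - σ|) * (t / √(p ^ 2 - t ^ 2))) t := by
  have hw2 : 0 < p ^ 2 - t ^ 2 := by nlinarith
  have hk2 : 0 < p ^ 2 - σ ^ 2 := by nlinarith
  have hwd := hasDerivAt_sqrt_sq_sub_sq hw2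
  have had := hasDerivAt_arcsin_div h0 hp
  have hw := Real.sqrt_pos.2 hw2
  have hk := Real.sqrt_pos.2 hk2
  have hws := Real.sq_sqrt hw2.le
  have hks := Real.sq_sqrt hk2.le
  unfold primLt
  set k := √(p ^ 2 - σ ^ 2)
  have hst : σ - t ≠ 0 := sub_ne_zero.2 hne.symm
  have hc : 0 < σ * √(p ^ 2 - t ^ 2) + k * t := by positivity
  have l1 : HasDerivAt (fun t => Real.log (σ - t)) (-1 / (σ - t)) t :=
    ((hasDerivAt_id t).const_sub σ).log hst
  have l2 : HasDerivAt (fun t => Real.log (σ + t)) (1 / (σ + t)) t :=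
    ((hasDerivAt_id t).const_add σ).log (by positivity)
  have l3 := ((hwd.const_mul σ).add ((hasDerivAt_id t).const_mul k)).log hc.ne'
  have key := ((((hwd.sub_const k).mul l1).sub ((hwd.add_const k).mul l2)).add
    (had.const_mul (2 * σ))).add (l3.const_mul (2 * k))
  refine key.congr_deriv ?_
  rw [Real.log_div (by positivity) (by simpa using sub_ne_zero.2 hne), Real.log_abs,
    ← Real.log_neg_eq_log (t - σ), neg_sub]
  simp only [id, mul_one, Pi.add_apply]
  generalize √(p ^ 2 - t ^ 2) = w at *
  generalize Real.log (σ - t) = A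
  generalize Real.log (σ + t) = B
  have h3 : σ + t ≠ 0 := by positivity
  have e : w ^ 2 - k ^ 2 = σ ^ 2 - t ^ 2 := by linarith
  have e0 : (w-k) * (-1 / (σ - t)) - (w+k) * (1/(σ+t)) + 2*σ*(1/w)
      + 2*k*((σ*(-t/w)+k)/(σ*w+k*t)) = 0 := by
    have h4 := hc.ne'
    field_simp
    have e1 : k ^ 2 = w ^ 2 - σ ^ 2 + t ^ 2 := by linarith
    ring_nf
    simp only [e1]
    ring
  linear_combination e0

lemma continuousOn_primLt {σ p : ℝ} (hσ : 0 < σ) (hσp : σ < p) :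
    ContinuousOn (primLt σ p) (Icc 0 p) := by
  have hk2 : 0 < p ^ 2 - σ ^ 2 := by nlinarith
  have hk := Real.sqrt_pos.2 hk2
  have hks := Real.sq_sqrt hk2.le
  have hcw : Continuous fun t : ℝ => √(p ^ 2 - t ^ 2) := by fun_prop
  have hc : ContinuousOn (fun t => (σ + t) / (√(p ^ 2 - t ^ 2) + √(p ^ 2 - σ ^ 2))
        * ((σ - t) * Real.log (σ - t))
      - (√(p ^ 2 - t ^ 2) + √(p ^ 2 - σ ^ 2)) * Real.log (σ + t)
      + 2 * σ * Real.arcsin (t / p)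
      + 2 * √(p ^ 2 - σ ^ 2) * Real.log (σ * √(p ^ 2 - t ^ 2) + √(p ^ 2 - σ ^ 2) * t))
      (Icc 0 p) := by
    have c1 : Continuous fun t => (σ - t) * Real.log (σ - t) :=
      Real.continuous_mul_log.comp (continuous_const.sub continuous_id)
    have c2 : Continuous fun t => Real.arcsin (t / p) :=
      Real.continuous_arcsin.comp (continuous_id.div_const p)
    refine ContinuousOn.add (ContinuousOn.add (ContinuousOn.sub (ContinuousOn.mul
      (ContinuousOn.div (by fun_prop) (by fun_prop) ?_) c1.continuousOn) (ContinuousOn.mul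
      (by fun_prop) (ContinuousOn.log (by fun_prop) ?_))) (by fun_prop)) (ContinuousOn.mul
      (by fun_prop) (ContinuousOn.log (by fun_prop) ?_))
    · intro t _; positivity
    · intro t ht; have := ht.1; positivity
    · intro t ht
      rcases ht.1.eq_or_lt with h | h
      · subst h
        have : 0 < √(p ^ 2 - 0 ^ 2) := Real.sqrt_pos.2 (by nlinarith)
        positivity
      · positivity
  refine hc.congr fun t ht => ?_
  have hws := Real.sq_sqrt (show 0 ≤ p ^ 2 - t ^ 2 by nlinarith [ht.1, ht.2])
  have : √(p ^ 2 - t ^ 2) - √(p ^ 2 - σ ^ 2)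
      = (σ + t) / (√(p ^ 2 - t ^ 2) + √(p ^ 2 - σ ^ 2)) * (σ - t) := by
    have : √(p ^ 2 - t ^ 2) + √(p ^ 2 - σ ^ 2) ≠ 0 := by positivity
    field_simp
    linear_combination hws - hks
  simp only [primLt]
  rw [this]
  ring

lemma primLt_sub {σ p : ℝ} (hσ : 0 < σ) (hσp : σ < p) :
    primLt σ p p - primLt σ p 0 = Real.pi * σ := by
  have hk2 : 0 < p ^ 2 - σ ^ 2 := by nlinarith
  have hk := Real.sqrt_pos.2 hk2
  have hp : 0 < p := hσ.trans hσp
  have hl : 2 * Real.log √(p ^ 2 - σ ^ 2) = Real.log (p - σ) + Real.log (σ + p) := by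
    rw [Real.log_sqrt hk2.le, ← Real.log_mul (by linarith) (by linarith)]
    ring_nf
  simp only [primLt, sub_self, Real.sqrt_zero, div_self hp.ne', Real.arcsin_one, mul_zero,
    zero_add, zero_div, Real.arcsin_zero, add_zero, sub_zero, ne_eq, OfNat.ofNat_ne_zero,
    not_false_eq_true, zero_pow, Real.sqrt_sq hp.le]
  rw [Real.log_mul hk.ne' hp.ne', Real.log_mul hσ.ne' hp.ne',
    ← Real.log_neg_eq_log (σ - p), neg_sub]
  linear_combination √(p ^ 2 - σ ^ 2) * hl

/-- Antiderivative of `t * log |(σ + t) / (σ - t)| / √(p² - t²)` when `p < σ`. -/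
noncomputable def primGt (σ p t : ℝ) : ℝ :=
  √(p ^ 2 - t ^ 2) * (Real.log (σ - t) - Real.log (σ + t))
    + 2 * σ * Real.arcsin (t / p)
    - 2 * √(σ ^ 2 - p ^ 2) * Real.arcsin (√(σ ^ 2 - p ^ 2) * t / (p * √(σ ^ 2 - t ^ 2)))

lemma hasDerivAt_primGt {σ p t : ℝ} (hσp : p < σ) (h0 : 0 < t) (hp : t < p) :
    HasDerivAt (primGt σ p) (Real.log ((σ + t) / |t - σ|) * (t / √(p ^ 2 - t ^ 2))) t := by
  have hp0 : 0 < p := h0.trans hp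
  have hw2 : 0 < p ^ 2 - t ^ 2 := by nlinarith
  have hk2 : 0 < σ ^ 2 - p ^ 2 := by nlinarith
  have hv2 : 0 < σ ^ 2 - t ^ 2 := by nlinarith
  have hwd := hasDerivAt_sqrt_sq_sub_sq hw2
  have hvd := hasDerivAt_sqrt_sq_sub_sq hv2
  have had := hasDerivAt_arcsin_div h0 hp
  have hw := Real.sqrt_pos.2 hw2
  have hk := Real.sqrt_pos.2 hk2
  have hv := Real.sqrt_pos.2 hv2
  have hws := Real.sq_sqrt hw2.le
  have hks := Real.sq_sqrt hk2.le
  have hvs := Real.sq_sqrt hv2.le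
  unfold primGt
  set k := √(σ ^ 2 - p ^ 2)
  have hst : 0 < σ - t := by linarith
  have l1 : HasDerivAt (fun t => Real.log (σ - t)) (-1 / (σ - t)) t :=
    ((hasDerivAt_id t).const_sub σ).log hst.ne'
  have l2 : HasDerivAt (fun t => Real.log (σ + t)) (1 / (σ + t)) t :=
    ((hasDerivAt_id t).const_add σ).log (by simp only [id]; linarith)
  have l3 := ((hasDerivAt_id t).const_mul k).div (hvd.const_mul p) (by positivity)
  simp only [id] at l3
  have hlt : k * t / (p * √(σ ^ 2 - t ^ 2)) < 1 := by
    rw [div_lt_one (by positivity)]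
    refine lt_of_pow_lt_pow_left₀ 2 (by positivity) ?_
    rw [mul_pow, mul_pow, hks, hvs]
    nlinarith
  have hgt : 0 < k * t / (p * √(σ ^ 2 - t ^ 2)) := by positivity
  have hsq : √(1 - (k * t / (p * √(σ ^ 2 - t ^ 2))) ^ 2)
      = σ * √(p ^ 2 - t ^ 2) / (p * √(σ ^ 2 - t ^ 2)) := by
    rw [Real.sqrt_eq_iff_eq_sq]
    · rw [div_pow, div_pow, mul_pow, mul_pow, mul_pow, hks, hvs, hws]
      field_simp
      ring
    · nlinarith
    · have : 0 < σ := by linarith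
      positivity
  have l4 := (Real.hasDerivAt_arcsin (by linarith) hlt.ne).comp t l3
  rw [hsq] at l4
  have key := ((hwd.mul (l1.sub l2)).add (had.const_mul (2 * σ))).sub (l4.const_mul (2 * k))
  refine key.congr_deriv ?_
  rw [Real.log_div (by linarith) (by simpa using sub_ne_zero.2 (by linarith)), Real.log_abs,
    ← Real.log_neg_eq_log (t - σ), neg_sub]
  simp only [mul_one, Pi.sub_apply]
  generalize √(p ^ 2 - t ^ 2) = w at *
  generalize √(σ ^ 2 - t ^ 2) = v at *
  generalize Real.log (σ - t) = A
  generalize Real.log (σ + t) = B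
  have h3 : σ + t ≠ 0 := by linarith
  have h5 : σ ≠ 0 := by linarith
  have e0 : w * (-1 / (σ - t) - 1 / (σ + t)) + 2 * σ * (1 / w)
      - 2 * k * (1 / (σ * w / (p * v)) * ((k * (p * v) - k * t * (p * (-t / v))) / (p * v) ^ 2))
      = 0 := by
    have h4 : (σ - t) * (σ + t) = v ^ 2 := by rw [hvs]; ring
    have h6 : -1 / (σ - t) - 1 / (σ + t) = - (2 * σ) / v ^ 2 := by
      rw [← h4]; field_simp; ring
    have h7 : k * (p * v) - k * t * (p * (-t / v)) = k * p * σ ^ 2 / v := by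
      field_simp; rw [hvs]; ring
    rw [h6, h7]
    field_simp
    rw [hvs, hws, hks]
    ring
  linear_combination e0

lemma continuousOn_primGt {σ p : ℝ} (hp : 0 < p) (hσp : p < σ) :
    ContinuousOn (primGt σ p) (Icc 0 p) := by
  have c2 : Continuous fun t => Real.arcsin (t / p) :=
    Real.continuous_arcsin.comp (continuous_id.div_const p)
  unfold primGt
  refine ContinuousOn.sub (ContinuousOn.add (ContinuousOn.mul (by fun_prop) (ContinuousOn.sub
    (ContinuousOn.log (by fun_prop) ?_) (ContinuousOn.log (by fun_prop) ?_))) (by fun_prop))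
    (ContinuousOn.mul (by fun_prop) (Real.continuous_arcsin.comp_continuousOn
    (ContinuousOn.div (by fun_prop) (by fun_prop) ?_)))
  · intro t ht; have := ht.2; linarith
  · intro t ht; have := ht.1; linarith
  · intro t ht
    have : 0 < √(σ ^ 2 - t ^ 2) := Real.sqrt_pos.2 (by nlinarith [ht.1, ht.2])
    positivity

lemma primGt_sub {σ p : ℝ} (hp : 0 < p) (hσp : p < σ) :
    primGt σ p p - primGt σ p 0 = Real.pi * (σ - √(σ ^ 2 - p ^ 2)) := by
  have hk : 0 < √(σ ^ 2 - p ^ 2) := Real.sqrt_pos.2 (by nlinarith)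
  have h1 : √(σ ^ 2 - p ^ 2) * p / (p * √(σ ^ 2 - p ^ 2)) = 1 := by field_simp
  simp [primGt, div_self hp.ne', h1]
  ring

lemma log_add_div_abs_sub_nonneg {σ t : ℝ} (hσ : 0 < σ) (ht : 0 < t) :
    0 ≤ Real.log ((σ + t) / |t - σ|) := by
  rcases eq_or_ne t σ with rfl | h
  · simp
  · refine Real.log_nonneg ((one_le_div (abs_pos.2 (sub_ne_zero.2 h))).2 (abs_le.2 ⟨?_, ?_⟩)) <;>
      linarith

lemma hasDerivAt_sqrt_sq_sub_const {m y : ℝ} (hm : 0 < m) (hy : m < y) :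
    HasDerivAt (fun y => √(y ^ 2 - m ^ 2)) (y / √(y ^ 2 - m ^ 2)) y := by
  have h : 0 < y ^ 2 - m ^ 2 := by nlinarith
  have h1 : HasDerivAt (fun y => y ^ 2 - m ^ 2) (2 * y) y := by
    simpa using ((hasDerivAt_id y).pow 2).sub_const (m ^ 2)
  convert h1.sqrt h.ne' using 1
  have := (Real.sqrt_pos.2 h).ne'
  field_simp

/-- The kernel after the substitution `t = √(y² - m²)`. -/
noncomputable def bandKernel (m ξ y : ℝ) : ℝ :=
  Real.log ((√(ξ ^ 2 - m ^ 2) + √(y ^ 2 - m ^ 2)) / |√(y ^ 2 - m ^ 2) - √(ξ ^ 2 - m ^ 2)|)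

lemma bandKernel_nonneg {m ξ y : ℝ} (hm : 0 < m) (hξ : m < ξ) (hy : m < y) :
    0 ≤ bandKernel m ξ y :=
  log_add_div_abs_sub_nonneg (Real.sqrt_pos.2 (by nlinarith)) (Real.sqrt_pos.2 (by nlinarith))

lemma measurable_bandKernel (m ξ : ℝ) : Measurable (bandKernel m ξ) := by
  unfold bandKernel
  fun_prop

lemma log_add_log_eq_bandKernel {m ξ y : ℝ} (hm : 0 < m) (hξ : m < ξ) (hy : m < y) (hne : y ≠ ξ) :
    Real.log ((y + ξ) / |y - ξ|)
      + Real.log ((√(ξ ^ 2 - m ^ 2) * √(y ^ 2 - m ^ 2) + ξ * y - m ^ 2)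
        / (√(ξ ^ 2 - m ^ 2) * √(y ^ 2 - m ^ 2) + ξ * y + m ^ 2)) = bandKernel m ξ y := by
  have hs2 : 0 < ξ ^ 2 - m ^ 2 := by nlinarith
  have ht2 : 0 < y ^ 2 - m ^ 2 := by nlinarith
  have hs := Real.sqrt_pos.2 hs2
  have ht := Real.sqrt_pos.2 ht2
  have hss := Real.sq_sqrt hs2.le
  have hts := Real.sq_sqrt ht2.le
  unfold bandKernel
  generalize √(ξ ^ 2 - m ^ 2) = s at *
  generalize √(y ^ 2 - m ^ 2) = t at *
  have hξ0 : 0 < ξ := hm.trans hξ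
  have hy0 : 0 < y := hm.trans hy
  have hd : 0 < |y - ξ| := abs_pos.2 (sub_ne_zero.2 hne)
  have hab : |t - s| * (s + t) = |y - ξ| * (y + ξ) := by
    rw [← abs_of_pos (show 0 < s + t by positivity), ← abs_of_pos (show 0 < y + ξ by positivity),
      ← abs_mul, ← abs_mul]
    congr 1
    linear_combination hts - hss
  have hd' : 0 < |t - s| := by
    have : 0 < |t - s| * (s + t) := by rw [hab]; positivity
    exact pos_of_mul_pos_left this (by positivity)
  have hnum : 0 < s * t + ξ * y - m ^ 2 := by nlinarith [mul_pos hs ht]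
  rw [← Real.log_mul (by positivity) (by positivity)]
  congr 1
  rw [div_mul_div_comm, div_eq_div_iff (by positivity) (by positivity)]
  refine mul_right_cancel₀ (show s + t ≠ 0 by positivity) ?_
  have key : (s * t + ξ * y - m ^ 2) * (y + ξ) ^ 2
      = (s + t) ^ 2 * (s * t + ξ * y + m ^ 2) := by
    have h1 : s ^ 2 = ξ ^ 2 - m ^ 2 := hss
    have h2 : t ^ 2 = y ^ 2 - m ^ 2 := hts
    have h3 : s ^ 3 = s * (ξ ^ 2 - m ^ 2) := by rw [← h1]; ring
    have h4 : t ^ 3 = t * (y ^ 2 - m ^ 2) := by rw [← h2]; ring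
    ring_nf
    simp only [h1, h2, h3, h4]
    ring
  calc (y + ξ) * (s * t + ξ * y - m ^ 2) * |t - s| * (s + t)
      = (y + ξ) * (s * t + ξ * y - m ^ 2) * (|t - s| * (s + t)) := by ring
    _ = |y - ξ| * ((s * t + ξ * y - m ^ 2) * (y + ξ) ^ 2) := by rw [hab]; ring
    _ = _ := by rw [key]; ring

/-- The integral of the kernel against `y / √(Q² - y²)`. -/
lemma integral_bandKernel {m ξ Q : ℝ} (hm : 0 < m) (hξ : m < ξ) (hQ : m < Q) (hne : Q ≠ ξ) :
    IntervalIntegrable (fun y => bandKernel m ξ y * (y / √(Q ^ 2 - y ^ 2))) volume m Q ∧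
      ∫ y in m..Q, bandKernel m ξ y * (y / √(Q ^ 2 - y ^ 2))
        = Real.pi * (√(ξ ^ 2 - m ^ 2) - √(ξ ^ 2 - Q ^ 2)) := by
  have hσ : 0 < √(ξ ^ 2 - m ^ 2) := Real.sqrt_pos.2 (by nlinarith)
  have hp : 0 < √(Q ^ 2 - m ^ 2) := Real.sqrt_pos.2 (by nlinarith)
  have hσ2 : √(ξ ^ 2 - m ^ 2) ^ 2 = ξ ^ 2 - m ^ 2 := Real.sq_sqrt (by nlinarith)
  have hp2 : √(Q ^ 2 - m ^ 2) ^ 2 = Q ^ 2 - m ^ 2 := Real.sq_sqrt (by nlinarith)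
  have mono : ∀ a b : ℝ, m ≤ a → a < b → √(a ^ 2 - m ^ 2) < √(b ^ 2 - m ^ 2) := fun a b ha hb =>
    Real.sqrt_lt_sqrt (by nlinarith) (by nlinarith)
  have hs0 : √(m ^ 2 - m ^ 2) = 0 := by simp
  have hcs : Continuous fun y : ℝ => √(y ^ 2 - m ^ 2) := by fun_prop
  have hmaps : MapsTo (fun y => √(y ^ 2 - m ^ 2)) (Icc m Q) (Icc 0 √(Q ^ 2 - m ^ 2)) :=
    fun y hy => ⟨Real.sqrt_nonneg _, Real.sqrt_le_sqrt (by nlinarith [hy.1, hy.2])⟩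
  have hcomp : ∀ G : ℝ → ℝ, ∀ y, m < y → y < Q →
      HasDerivAt G (Real.log ((√(ξ ^ 2 - m ^ 2) + √(y ^ 2 - m ^ 2))
        / |√(y ^ 2 - m ^ 2) - √(ξ ^ 2 - m ^ 2)|)
        * (√(y ^ 2 - m ^ 2) / √(√(Q ^ 2 - m ^ 2) ^ 2 - √(y ^ 2 - m ^ 2) ^ 2))) √(y ^ 2 - m ^ 2) →
      HasDerivAt (fun y => G √(y ^ 2 - m ^ 2))
        (bandKernel m ξ y * (y / √(Q ^ 2 - y ^ 2))) y := by
    intro G y hy hyQ hG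
    refine (HasDerivAt.comp y hG (hasDerivAt_sqrt_sq_sub_const hm hy)).congr_deriv ?_
    have ht : 0 < √(y ^ 2 - m ^ 2) := Real.sqrt_pos.2 (by nlinarith)
    rw [hp2, Real.sq_sqrt (show 0 ≤ y ^ 2 - m ^ 2 by nlinarith), sub_sub_sub_cancel_right,
      bandKernel]
    have : 0 < √(Q ^ 2 - y ^ 2) := Real.sqrt_pos.2 (by nlinarith)
    field_simp
  have hnn : ∀ y, m < y → 0 ≤ bandKernel m ξ y * (y / √(Q ^ 2 - y ^ 2)) := fun y hy =>
    mul_nonneg (bandKernel_nonneg hm hξ hy) (div_nonneg (hm.trans hy).le (Real.sqrt_nonneg _))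
  rcases hne.lt_or_gt with h | h
  · have hlt := mono Q ξ hQ.le h
    have := integrable_and_integral_eq_sub_of_hasDerivAt_of_nonneg hQ.le
      ((continuousOn_primGt hp hlt).comp hcs.continuousOn hmaps)
      (fun y hy => hcomp _ y hy.1 hy.2 (hasDerivAt_primGt hlt
        (Real.sqrt_pos.2 (by nlinarith [hy.1])) (mono y Q hy.1.le hy.2)))
      (fun y hy => hnn y hy.1)
    refine ⟨this.1, this.2.trans ?_⟩
    simp only [Function.comp, hs0]
    rw [primGt_sub hp hlt, hσ2, hp2, sub_sub_sub_cancel_right]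
  · have hlt := mono ξ Q hξ.le h
    have hc := (continuousOn_primLt hσ hlt).comp hcs.continuousOn hmaps
    have hd : ∀ y, m < y → y < Q → y ≠ ξ →
        HasDerivAt (primLt √(ξ ^ 2 - m ^ 2) √(Q ^ 2 - m ^ 2) ∘ fun y => √(y ^ 2 - m ^ 2))
          (bandKernel m ξ y * (y / √(Q ^ 2 - y ^ 2))) y := by
      intro y h1 h2 h3
      refine hcomp _ y h1 h2 (hasDerivAt_primLt hσ hlt
        (Real.sqrt_pos.2 (by nlinarith)) (mono y Q h1.le h2) ?_)
      rcases h3.lt_or_gt with h3 | h3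
      · exact (mono y ξ h1.le h3).ne
      · exact (mono ξ y hξ.le h3).ne'
    have i1 := integrable_and_integral_eq_sub_of_hasDerivAt_of_nonneg hξ.le
      (hc.mono (Icc_subset_Icc_right h.le))
      (fun y hy => hd y hy.1 (hy.2.trans h) hy.2.ne) (fun y hy => hnn y hy.1)
    have i2 := integrable_and_integral_eq_sub_of_hasDerivAt_of_nonneg h.le
      (hc.mono (Icc_subset_Icc_left hξ.le))
      (fun y hy => hd y (hξ.trans hy.1) hy.2 hy.1.ne') (fun y hy => hnn y (hξ.trans hy.1))
    refine ⟨i1.1.trans i2.1, ?_⟩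
    rw [← intervalIntegral.integral_add_adjacent_intervals i1.1 i2.1, i1.2, i2.2,
      Real.sqrt_eq_zero_of_nonpos (show ξ ^ 2 - Q ^ 2 ≤ 0 by nlinarith), sub_zero,
      ← primLt_sub hσ hlt]
    simp only [Function.comp, hs0]
    ring

lemma exists_pos_mul_sub_le {L : ℝ} (hL : 0 < L) {q : ℝ → ℝ} (hq : ContDiffOn ℝ 1 q (Icc 0 L))
    (hq' : ∀ x ∈ Icc (0 : ℝ) L, derivWithin q (Icc 0 L) x < 0) :
    ∃ c > 0, ∀ x ∈ Icc 0 L, ∀ y ∈ Icc 0 L, x ≤ y → c * (y - x) ≤ q x - q y := by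
  have hd : ContinuousOn (derivWithin q (Icc 0 L)) (Icc 0 L) :=
    hq.continuousOn_derivWithin (uniqueDiffOn_Icc hL) le_rfl
  obtain ⟨z, hz, hmax⟩ := isCompact_Icc.exists_isMaxOn (nonempty_Icc.2 hL.le) hd
  refine ⟨-derivWithin q (Icc 0 L) z, neg_pos.2 (hq' z hz), fun x hx y hy hxy => ?_⟩
  have := (convex_Icc 0 L).image_sub_le_mul_sub_of_deriv_le hq.continuousOn
    ((hq.differentiableOn one_ne_zero).mono interior_subset)
    (C := derivWithin q (Icc 0 L) z) (fun w hw => ?_) x hx y hy hxy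
  · linarith
  · rw [← derivWithin_of_mem_nhds (mem_interior_iff_mem_nhds.1 hw)]
    exact hmax (interior_subset hw)

lemma intervalIntegrable_one_div_sqrt_sq_sub_sq {a c y : ℝ} (ha : 0 ≤ a) (hc : 0 < c) (hy : 0 < y)
    {q : ℝ → ℝ} (hq : ContinuousOn q (Icc 0 a))
    (hqc : ∀ x ∈ Icc 0 a, c * (a - x) ≤ q x - y) :
    IntervalIntegrable (fun x => 1 / √(q x ^ 2 - y ^ 2)) volume 0 a := by
  have hr : IntervalIntegrable (fun x => (√(c * (2 * y)))⁻¹ * (a - x) ^ (-(1 / 2) : ℝ))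
      volume 0 a := by
    have h := (intervalIntegral.intervalIntegrable_rpow' (a := a) (b := 0)
      (show (-1 : ℝ) < -(1 / 2) by norm_num)).comp_sub_left a
    simp only [sub_self, sub_zero] at h
    exact h.const_mul _
  rw [intervalIntegrable_iff_integrableOn_Ioc_of_le ha] at hr ⊢
  have hqm : AEMeasurable q (volume.restrict (Ioc 0 a)) :=
    (hq.mono Ioc_subset_Icc_self).aemeasurable measurableSet_Ioc
  refine Integrable.mono' hr (AEMeasurable.aestronglyMeasurable (by fun_prop)) ?_
  filter_upwards [ae_restrict_mem measurableSet_Ioc,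
    ae_restrict_of_ae (Measure.ae_ne volume a)] with x hx hxa
  rw [Real.norm_of_nonneg (by positivity)]
  have hax : 0 < a - x := sub_pos.2 (lt_of_le_of_ne hx.2 hxa)
  have h1 := hqc x ⟨hx.1.le, hx.2⟩
  have h2 : c * (2 * y) * (a - x) ≤ q x ^ 2 - y ^ 2 := by
    have : 0 < c * (a - x) := by positivity
    nlinarith
  rw [Real.rpow_neg hax.le, ← Real.sqrt_eq_rpow, ← mul_inv, ← Real.sqrt_mul (by positivity),
    ← one_div]
  exact one_div_le_one_div_of_le (Real.sqrt_pos.2 (by positivity)) (Real.sqrt_le_sqrt h2)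

/-- Theorem 4.2 of the paper (periodic fNLS breather gas), in real variables:
the density of states `u(y) = (y/(πL)) ∫₀^{q⁻¹(y)} (q(x)² − y²)^{−1/2} dx`
solves the breather-gas nonlinear dispersion relation with permanent band `[−im, im]`. -/
theorem stmt_1
    (L m M : ℝ) (hL : 0 < L) (hm : 0 < m) (hmM : m < M)
    (q qinv : ℝ → ℝ)
    (hq : ContDiffOn ℝ 1 q (Icc 0 L))
    (hq' : ∀ x ∈ Icc (0:ℝ) L, derivWithin q (Icc 0 L) x < 0)
    (hq0 : q 0 = M) (hqL : q L = m)
    (hinv_left : ∀ x ∈ Icc (0:ℝ) L, qinv (q x) = x)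
    (hinv_right : ∀ y ∈ Icc m M, q (qinv y) = y)
    (u : ℝ → ℝ)
    (hu : ∀ y ∈ Ioo m M,
      u y = (y / (Real.pi * L)) * ∫ x in (0:ℝ)..(qinv y), 1 / Real.sqrt (q x ^ 2 - y ^ 2))
    (s : ℝ → ℝ)
    (hs : ∀ t, m ≤ t → s t = Real.sqrt (t ^ 2 - m ^ 2)) :
    (∀ y ∈ Ioo m M,
      IntervalIntegrable (fun x => 1 / Real.sqrt (q x ^ 2 - y ^ 2)) volume 0 (qinv y)) ∧
    (∀ ξ ∈ Ioo m M,
      IntervalIntegrable (fun y =>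
        (Real.log ((y + ξ) / |y - ξ|)
          + Real.log ((s ξ * s y + ξ * y - m ^ 2) / (s ξ * s y + ξ * y + m ^ 2))) * u y)
        volume m M ∧
      IntervalIntegrable (fun x => Real.sqrt (ξ ^ 2 - q x ^ 2)) volume (qinv ξ) L ∧
      (∫ y in m..M,
        (Real.log ((y + ξ) / |y - ξ|)
          + Real.log ((s ξ * s y + ξ * y - m ^ 2) / (s ξ * s y + ξ * y + m ^ 2))) * u y)
        + (1 / L) * ∫ x in (qinv ξ)..L, Real.sqrt (ξ ^ 2 - q x ^ 2) = s ξ) := by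
  have hqc : ContinuousOn q (Icc 0 L) := hq.continuousOn
  obtain ⟨c, hc, hslope⟩ := exists_pos_mul_sub_le hL hq hq'
  have hanti : ∀ x ∈ Icc 0 L, ∀ y ∈ Icc 0 L, x < y → q y < q x := fun x hx y hy hxy => by
    have := hslope x hx y hy hxy.le
    have : 0 < c * (y - x) := mul_pos hc (sub_pos.2 hxy)
    linarith
  have hmem : ∀ y ∈ Icc m M, qinv y ∈ Icc 0 L := fun y hy => by
    obtain ⟨x, hx, rfl⟩ := intermediate_value_Icc' hL.le hqc (by rwa [hq0, hqL])
    rwa [hinv_left x hx]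
  have hgt : ∀ y ∈ Icc m M, ∀ x ∈ Icc 0 L, x < qinv y → y < q x := fun y hy x hx h => by
    simpa only [hinv_right y hy] using hanti x hx _ (hmem y hy) h
  have hlt : ∀ y ∈ Icc m M, ∀ x ∈ Icc 0 L, qinv y < x → q x < y := fun y hy x hx h => by
    simpa only [hinv_right y hy] using hanti _ (hmem y hy) x hx h
  have hrange : ∀ x ∈ Ioo 0 L, q x ∈ Ioo m M := fun x hx =>
    ⟨hqL ▸ hanti x (Ioo_subset_Icc_self hx) L ⟨hL.le, le_rfl⟩ hx.2,
      hq0 ▸ hanti 0 ⟨le_rfl, hL.le⟩ x (Ioo_subset_Icc_self hx) hx.1⟩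
  have hint : ∀ y ∈ Ioo m M,
      IntervalIntegrable (fun x => 1 / √(q x ^ 2 - y ^ 2)) volume 0 (qinv y) := fun y hy => by
    have hy' := Ioo_subset_Icc_self hy
    have ha := hmem y hy'
    refine intervalIntegrable_one_div_sqrt_sq_sub_sq ha.1 hc (hm.trans hy.1)
      (hqc.mono (Icc_subset_Icc_right ha.2)) fun x hx => ?_
    simpa only [hinv_right y hy'] using hslope x ⟨hx.1, hx.2.trans ha.2⟩ _ ha hx.2
  refine ⟨hint, fun ξ hξ => ?_⟩
  have hξ' := Ioo_subset_Icc_self hξ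
  have haξ := hmem ξ hξ'
  have hsq : ∀ a ∈ Icc 0 L, ∀ b ∈ Icc 0 L,
      IntervalIntegrable (fun x => √(ξ ^ 2 - q x ^ 2)) volume a b := fun a ha b hb =>
    ContinuousOn.intervalIntegrable (((continuousOn_const.sub (hqc.pow 2)).sqrt).mono
      (uIcc_subset_Icc ha hb))
  have h0L : (0 : ℝ) ∈ Icc 0 L := ⟨le_rfl, hL.le⟩
  have hLL : L ∈ Icc 0 L := ⟨hL.le, le_rfl⟩
  set F : ℝ → ℝ → ℝ := fun x y => bandKernel m ξ y * (y / √(q x ^ 2 - y ^ 2)) with hF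
  set J : ℝ → ℝ := fun x => Real.pi * (√(ξ ^ 2 - m ^ 2) - √(ξ ^ 2 - q x ^ 2)) with hJ
  have hFnn : ∀ x, ∀ y ∈ Ioc m M, 0 ≤ F x y := fun x y hy =>
    mul_nonneg (bandKernel_nonneg hm hξ.1 hy.1)
      (div_nonneg (hm.trans hy.1).le (Real.sqrt_nonneg _))
  have hFx : ∀ x ∈ Ioo 0 L, x ≠ qinv ξ →
      IntegrableOn (F x) (Ioc m M) ∧ ∫ y in Ioc m M, F x y = J x := fun x hx hne => by
    have hr := hrange x hx
    obtain ⟨h1, h2⟩ := integral_bandKernel hm hξ.1 hr.1 fun h => hne <| by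
      rw [← h, hinv_left x (Ioo_subset_Icc_self hx)]
    rw [intervalIntegrable_iff_integrableOn_Ioc_of_le hr.1.le] at h1
    rw [intervalIntegral.integral_of_le hr.1.le] at h2
    have hz : ∀ y ∈ Ioc m M \ Ioc m (q x), F x y = 0 := fun y hy => by
      have : q x < y := not_le.1 fun h => hy.2 ⟨hy.1.1, h⟩
      simp only [hF]
      rw [Real.sqrt_eq_zero_of_nonpos (by nlinarith [hr.1]), div_zero, mul_zero]
    have hsub : Ioc m (q x) ⊆ Ioc m M := Ioc_subset_Ioc_right hr.2.le
    refine ⟨h1.of_forall_sdiff_eq_zero measurableSet_Ioc hz, ?_⟩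
    simp only [hJ, ← h2]
    exact (setIntegral_eq_of_subset_of_forall_sdiff_eq_zero measurableSet_Ioc hsub hz)
  have hae : ∀ᵐ x ∂volume.restrict (Ioc 0 L), x ∈ Ioo 0 L ∧ x ≠ qinv ξ := by
    rw [← Measure.restrict_congr_set (Ioo_ae_eq_Ioc (μ := volume) (a := (0 : ℝ)) (b := L))]
    filter_upwards [ae_restrict_mem measurableSet_Ioo,
      ae_restrict_of_ae (Measure.ae_ne volume (qinv ξ))] with x h1 h2 using ⟨h1, h2⟩
  have hJint : IntervalIntegrable J volume 0 L :=
    (intervalIntegrable_const.sub (hsq 0 h0L L hLL)).const_mul _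
  have hqm : AEMeasurable q (volume.restrict (Ioc 0 L)) :=
    (hqc.mono Ioc_subset_Icc_self).aemeasurable measurableSet_Ioc
  have hFint : Integrable (Function.uncurry F)
      ((volume.restrict (Ioc 0 L)).prod (volume.restrict (Ioc m M))) := by
    have hmeas : AEStronglyMeasurable (Function.uncurry F)
        ((volume.restrict (Ioc 0 L)).prod (volume.restrict (Ioc m M))) := by
      refine AEMeasurable.aestronglyMeasurable ?_
      have h1 : AEMeasurable (fun z : ℝ × ℝ => q z.1)
        ((volume.restrict (Ioc 0 L)).prod (volume.restrict (Ioc m M))) := hqm.comp_fst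
      have h2 : Measurable fun z : ℝ × ℝ => bandKernel m ξ z.2 :=
        (measurable_bandKernel m ξ).comp measurable_snd
      exact h2.aemeasurable.mul (measurable_snd.aemeasurable.div
        ((h1.pow_const 2).sub (measurable_snd.pow_const 2).aemeasurable).sqrt)
    refine (integrable_prod_iff hmeas).2 ⟨?_, ?_⟩
    · filter_upwards [hae] with x hx using (hFx x hx.1 hx.2).1
    · refine ((intervalIntegrable_iff_integrableOn_Ioc_of_le hL.le).1 hJint).congr ?_
      filter_upwards [hae] with x hx
      rw [← (hFx x hx.1 hx.2).2]
      refine setIntegral_congr_fun measurableSet_Ioc fun y hy => ?_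
      exact (Real.norm_of_nonneg (hFnn x y hy)).symm
  have hFy : ∀ y ∈ Ioo m M, y ≠ ξ → 1 / (Real.pi * L) * ∫ x in Ioc 0 L, F x y
      = (Real.log ((y + ξ) / |y - ξ|)
        + Real.log ((s ξ * s y + ξ * y - m ^ 2) / (s ξ * s y + ξ * y + m ^ 2))) * u y :=
      fun y hy hne => by
    have hy' := Ioo_subset_Icc_self hy
    have ha := hmem y hy'
    rw [hs ξ hξ.1.le, hs y hy.1.le, log_add_log_eq_bandKernel hm hξ.1 hy.1 hne, hu y hy,
      intervalIntegral.integral_of_le ha.1]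
    have hz : ∀ x ∈ Ioc 0 L \ Ioc 0 (qinv y), 1 / √(q x ^ 2 - y ^ 2) = 0 := fun x hx => by
      have h1 : qinv y < x := not_le.1 fun h => hx.2 ⟨hx.1.1, h⟩
      have h2 := hlt y hy' x (Ioc_subset_Icc_self hx.1) h1
      have h3 : m ≤ q x := by
        rcases hx.1.2.eq_or_lt with h | h
        · rw [h, hqL]
        · exact (hrange x ⟨hx.1.1, h⟩).1.le
      rw [Real.sqrt_eq_zero_of_nonpos (by nlinarith), div_zero]
    rw [← setIntegral_eq_of_subset_of_forall_sdiff_eq_zero measurableSet_Ioc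
      (Ioc_subset_Ioc_right ha.2) hz]
    have : ∀ x, F x y = bandKernel m ξ y * y * (1 / √(q x ^ 2 - y ^ 2)) := fun x => by
      simp only [hF]; ring
    simp only [this]
    rw [integral_const_mul]
    ring
  have haey : (fun y => 1 / (Real.pi * L) * ∫ x in Ioc 0 L, F x y)
      =ᵐ[volume.restrict (Ioc m M)] fun y => (Real.log ((y + ξ) / |y - ξ|)
        + Real.log ((s ξ * s y + ξ * y - m ^ 2) / (s ξ * s y + ξ * y + m ^ 2))) * u y := by
    rw [← Measure.restrict_congr_set (Ioo_ae_eq_Ioc (μ := volume) (a := m) (b := M))]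
    filter_upwards [ae_restrict_mem measurableSet_Ioo,
      ae_restrict_of_ae (Measure.ae_ne volume ξ)] with y h1 h2 using hFy y h1 h2
  refine ⟨?_, hsq _ haξ _ hLL, ?_⟩
  · rw [intervalIntegrable_iff_integrableOn_Ioc_of_le hmM.le]
    exact (hFint.integral_prod_right.const_mul _).congr haey
  have hJx : ∫ x in Ioc 0 L, ∫ y in Ioc m M, F x y = ∫ x in (0 : ℝ)..L, J x := by
    rw [intervalIntegral.integral_of_le hL.le]
    refine integral_congr_ae ?_
    filter_upwards [hae] with x hx using (hFx x hx.1 hx.2).2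
  have hzero : ∫ x in (0 : ℝ)..(qinv ξ), √(ξ ^ 2 - q x ^ 2) = 0 := by
    rw [intervalIntegral.integral_of_le haξ.1]
    refine setIntegral_eq_zero_of_forall_eq_zero fun x hx => ?_
    have h1 : ξ ≤ q x := by
      rcases hx.2.eq_or_lt with h | h
      · rw [h, hinv_right ξ hξ']
      · exact (hgt ξ hξ' x ⟨hx.1.le, hx.2.trans haξ.2⟩ h).le
    exact Real.sqrt_eq_zero_of_nonpos (by nlinarith [hm.trans hξ.1])
  rw [intervalIntegral.integral_of_le hmM.le, ← integral_congr_ae haey, integral_const_mul,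
    ← integral_integral_swap hFint, hJx, intervalIntegral.integral_const_mul,
    intervalIntegral.integral_sub intervalIntegrable_const (hsq 0 h0L L hLL),
    ← intervalIntegral.integral_add_adjacent_intervals (hsq 0 h0L _ haξ) (hsq _ haξ L hLL),
    hzero, intervalIntegral.integral_const, hs ξ hξ.1.le]
  have := Real.pi_ne_zero
  simp only [sub_zero, zero_add, smul_eq_mul]
  field_simp
  ring
end

section
/- Let Q > 0. Then for every ξ ∈ (0,Q), ∫₀^Q log((y+ξ)/|y−ξ|) · ( y / (π √(Q² − y²)) ) dy = ξ (the improper integral converges). -/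
open MeasureTheory

/-- An antiderivative of `y ↦ log ((y + ξ) / |y - ξ|) * (y / √(Q² - y²))`. -/
noncomputable def condensatePrimitive (Q ξ y : ℝ) : ℝ :=
  (√(Q ^ 2 - y ^ 2) - √(Q ^ 2 - ξ ^ 2)) * Real.log (y - ξ)
    - (√(Q ^ 2 - y ^ 2) + √(Q ^ 2 - ξ ^ 2)) * Real.log (y + ξ)
    + 2 * √(Q ^ 2 - ξ ^ 2) * Real.log (ξ * √(Q ^ 2 - y ^ 2) + y * √(Q ^ 2 - ξ ^ 2))
    + 2 * ξ * Real.arcsin (y / Q)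

lemma sqrt_sq_sub_sq_pos {Q y : ℝ} (hy : 0 ≤ y) (hyQ : y < Q) : 0 < √(Q ^ 2 - y ^ 2) :=
  Real.sqrt_pos.2 (by nlinarith)

lemma continuousOn_condensatePrimitive {Q ξ : ℝ} (hξ : 0 < ξ) (hξQ : ξ < Q) :
    ContinuousOn (condensatePrimitive Q ξ) (Set.Icc 0 Q) := by
  have hc := sqrt_sq_sub_sq_pos hξ.le hξQ
  have hQ : 0 < Q := hξ.trans hξQ
  have key : ∀ y ∈ Set.Icc 0 Q, condensatePrimitive Q ξ y =
      -((y + ξ) / (√(Q ^ 2 - y ^ 2) + √(Q ^ 2 - ξ ^ 2))) * ((y - ξ) * Real.log (y - ξ))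
      - (√(Q ^ 2 - y ^ 2) + √(Q ^ 2 - ξ ^ 2)) * Real.log (y + ξ)
      + 2 * √(Q ^ 2 - ξ ^ 2) * Real.log (ξ * √(Q ^ 2 - y ^ 2) + y * √(Q ^ 2 - ξ ^ 2))
      + 2 * ξ * Real.arcsin (y / Q) := by
    rintro y ⟨hy, hyQ⟩
    have hs := Real.sqrt_nonneg (Q ^ 2 - y ^ 2)
    have hs2 : √(Q ^ 2 - y ^ 2) ^ 2 = Q ^ 2 - y ^ 2 := Real.sq_sqrt (by nlinarith)
    have hc2 : √(Q ^ 2 - ξ ^ 2) ^ 2 = Q ^ 2 - ξ ^ 2 := Real.sq_sqrt (by nlinarith)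
    have hd : √(Q ^ 2 - y ^ 2) - √(Q ^ 2 - ξ ^ 2) =
        -((y + ξ) / (√(Q ^ 2 - y ^ 2) + √(Q ^ 2 - ξ ^ 2))) * (y - ξ) := by
      have : √(Q ^ 2 - y ^ 2) + √(Q ^ 2 - ξ ^ 2) ≠ 0 := by positivity
      field_simp
      linear_combination hs2 - hc2
    rw [condensatePrimitive, hd]
    ring
  refine ContinuousOn.congr ?_ key
  have hs : ContinuousOn (fun y : ℝ => √(Q ^ 2 - y ^ 2)) (Set.Icc 0 Q) := by fun_prop
  refine ((ContinuousOn.mul ?_ ?_).sub (ContinuousOn.mul ?_ ?_)).add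
    (ContinuousOn.mul ?_ ?_) |>.add (ContinuousOn.mul ?_ ?_)
  · refine (ContinuousOn.div (by fun_prop) (by fun_prop) fun y _ => ?_).neg
    positivity
  · exact (Real.continuous_mul_log.comp (continuous_id.sub continuous_const)).continuousOn
  · fun_prop
  · refine ContinuousOn.log (by fun_prop) fun y hy => ?_
    have := hy.1
    positivity
  · fun_prop
  · refine ContinuousOn.log (by fun_prop) fun y hy => ?_
    rcases hy.1.eq_or_lt with rfl | h0
    · have := sqrt_sq_sub_sq_pos le_rfl hQ
      positivity
    · positivity
  · fun_prop
  · exact (Real.continuous_arcsin.comp (continuous_id.div_const Q)).continuousOn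

lemma hasDerivAt_condensatePrimitive {Q ξ y : ℝ} (hξ : 0 < ξ) (hξQ : ξ < Q) (hy : 0 < y)
    (hyQ : y < Q) (hne : y ≠ ξ) :
    HasDerivAt (condensatePrimitive Q ξ)
      (Real.log ((y + ξ) / |y - ξ|) * (y / √(Q ^ 2 - y ^ 2))) y := by
  have hc := sqrt_sq_sub_sq_pos hξ.le hξQ
  have hs := sqrt_sq_sub_sq_pos hy.le hyQ
  have hQ : 0 < Q := hξ.trans hξQ
  have hs2 : √(Q ^ 2 - y ^ 2) ^ 2 = Q ^ 2 - y ^ 2 := Real.sq_sqrt (by nlinarith)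
  have hc2 : √(Q ^ 2 - ξ ^ 2) ^ 2 = Q ^ 2 - ξ ^ 2 := Real.sq_sqrt (by nlinarith)
  have hyξ : y - ξ ≠ 0 := sub_ne_zero.2 hne
  have hyξ' : y + ξ ≠ 0 := by positivity
  have hden : ξ * √(Q ^ 2 - y ^ 2) + y * √(Q ^ 2 - ξ ^ 2) ≠ 0 := by positivity
  have dS : HasDerivAt (fun y : ℝ => √(Q ^ 2 - y ^ 2)) (-y / √(Q ^ 2 - y ^ 2)) y := by
    refine (((hasDerivAt_pow 2 y).const_sub (Q ^ 2)).sqrt (by nlinarith)).congr_deriv ?_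
    push_cast
    field_simp
  have dA : HasDerivAt (fun y : ℝ => Real.arcsin (y / Q)) (1 / √(Q ^ 2 - y ^ 2)) y := by
    have hlt : y / Q < 1 := (div_lt_one hQ).2 hyQ
    have hgt : -1 < y / Q := neg_one_lt_zero.trans (by positivity)
    refine ((Real.hasDerivAt_arcsin hgt.ne' hlt.ne).comp y
      ((hasDerivAt_id y).div_const Q)).congr_deriv ?_
    have : 1 - (y / Q) ^ 2 = (Q ^ 2 - y ^ 2) / Q ^ 2 := by field_simp
    rw [this, Real.sqrt_div' _ (by positivity), Real.sqrt_sq hQ.le]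
    field_simp
  have dM := ((hasDerivAt_id y).sub_const ξ).log hyξ
  have dP := ((hasDerivAt_id y).add_const ξ).log hyξ'
  have dL := ((dS.const_mul ξ).add ((hasDerivAt_id y).mul_const √(Q ^ 2 - ξ ^ 2))).log hden
  have := ((((dS.sub_const √(Q ^ 2 - ξ ^ 2)).mul dM).sub
    ((dS.add_const √(Q ^ 2 - ξ ^ 2)).mul dP)).add
      (dL.const_mul (2 * √(Q ^ 2 - ξ ^ 2)))).add (dA.const_mul (2 * ξ))
  refine this.congr_deriv ?_
  rw [Real.log_div hyξ' (abs_ne_zero.2 hyξ), Real.log_abs]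
  simp only [id, Pi.add_apply, one_mul]
  have hL : (ξ * (-y / √(Q ^ 2 - y ^ 2)) + √(Q ^ 2 - ξ ^ 2)) /
      (ξ * √(Q ^ 2 - y ^ 2) + y * √(Q ^ 2 - ξ ^ 2)) =
      (√(Q ^ 2 - ξ ^ 2) * ξ - y * √(Q ^ 2 - y ^ 2)) /
        (√(Q ^ 2 - y ^ 2) * (-(y - ξ) * (y + ξ))) := by
    generalize √(Q ^ 2 - y ^ 2) = s at *
    generalize √(Q ^ 2 - ξ ^ 2) = c at *
    rw [div_eq_div_iff hden (mul_ne_zero hs.ne' (mul_ne_zero (neg_ne_zero.2 hyξ) hyξ'))]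
    field_simp
    linear_combination (ξ * y) * (hs2 - hc2)
  rw [hL]
  generalize √(Q ^ 2 - y ^ 2) = s at *
  generalize √(Q ^ 2 - ξ ^ 2) = c at *
  field_simp
  linear_combination 2 * ξ * (hs2 - hc2)

lemma condensatePrimitive_zero {Q ξ : ℝ} (hξ : 0 < ξ) (hξQ : ξ < Q) :
    condensatePrimitive Q ξ 0 = 2 * √(Q ^ 2 - ξ ^ 2) * Real.log Q := by
  have hQ : 0 < Q := hξ.trans hξQ
  simp [condensatePrimitive, Real.sqrt_sq hQ.le, Real.log_mul hξ.ne' hQ.ne']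
  ring

lemma condensatePrimitive_self {Q ξ : ℝ} (hξ : 0 < ξ) (hξQ : ξ < Q) :
    condensatePrimitive Q ξ Q = 2 * √(Q ^ 2 - ξ ^ 2) * Real.log Q + Real.pi * ξ := by
  have hQ : 0 < Q := hξ.trans hξQ
  have hc := sqrt_sq_sub_sq_pos hξ.le hξQ
  have hlog : 2 * Real.log √(Q ^ 2 - ξ ^ 2) = Real.log (Q - ξ) + Real.log (Q + ξ) := by
    rw [Real.log_sqrt (by nlinarith), ← Real.log_mul (sub_pos.2 hξQ).ne' (by positivity)]
    ring_nf
  simp [condensatePrimitive, Real.log_mul hQ.ne' hc.ne', div_self hQ.ne']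
  linear_combination √(Q ^ 2 - ξ ^ 2) * hlog

lemma log_add_div_abs_sub_nonneg_s4 {ξ y : ℝ} (hξ : 0 < ξ) (hy : 0 < y) (hne : y ≠ ξ) :
    0 ≤ Real.log ((y + ξ) / |y - ξ|) := by
  refine Real.log_nonneg ((one_le_div (abs_pos.2 (sub_ne_zero.2 hne))).2 ?_)
  rw [abs_le]
  constructor <;> linarith

/-- On an interval whose interior avoids the singularity `ξ`, the integrand is integrable and
its integral is given by the primitive. -/
lemma integral_log_mul_eq_sub {Q ξ a b : ℝ} (hξ : 0 < ξ) (hξQ : ξ < Q) (ha : 0 ≤ a) (hab : a ≤ b)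
    (hb : b ≤ Q) (hne : ∀ y ∈ Set.Ioo a b, y ≠ ξ) :
    IntervalIntegrable (fun y => Real.log ((y + ξ) / |y - ξ|) * (y / √(Q ^ 2 - y ^ 2)))
        volume a b ∧
      ∫ y in a..b, Real.log ((y + ξ) / |y - ξ|) * (y / √(Q ^ 2 - y ^ 2)) =
        condensatePrimitive Q ξ b - condensatePrimitive Q ξ a := by
  have hcont := (continuousOn_condensatePrimitive hξ hξQ).mono (Set.Icc_subset_Icc ha hb)
  have hderiv : ∀ y ∈ Set.Ioo a b, HasDerivAt (condensatePrimitive Q ξ)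
      (Real.log ((y + ξ) / |y - ξ|) * (y / √(Q ^ 2 - y ^ 2))) y := fun y hy =>
    hasDerivAt_condensatePrimitive hξ hξQ (ha.trans_lt hy.1) (hy.2.trans_le hb) (hne y hy)
  have hint : IntervalIntegrable
      (fun y => Real.log ((y + ξ) / |y - ξ|) * (y / √(Q ^ 2 - y ^ 2))) volume a b := by
    refine intervalIntegral.intervalIntegrable_deriv_of_nonneg (g := condensatePrimitive Q ξ)
      (by rwa [Set.uIcc_of_le hab]) (by rwa [min_eq_left hab, max_eq_right hab]) ?_
    rw [min_eq_left hab, max_eq_right hab]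
    intro y hy
    have hy0 : 0 < y := ha.trans_lt hy.1
    exact mul_nonneg (log_add_div_abs_sub_nonneg_s4 hξ hy0 (hne y hy)) (by positivity)
  exact ⟨hint, intervalIntegral.integral_eq_sub_of_hasDerivAt_of_le hab hcont hderiv hint⟩

/-- The genus-zero bound-state soliton condensate: `u(y) = y/(π√(Q²−y²))` solves the
soliton-gas dispersion relation with `σ ≡ 0` on `[0,iQ]`, in real variables. -/
theorem stmt_4 (Q : ℝ) (hQ : 0 < Q) :
    ∀ ξ ∈ Set.Ioo (0:ℝ) Q,
      IntervalIntegrable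
        (fun y => Real.log ((y + ξ) / |y - ξ|) * (y / (Real.pi * Real.sqrt (Q ^ 2 - y ^ 2))))
        volume 0 Q ∧
      ∫ y in (0:ℝ)..Q,
        Real.log ((y + ξ) / |y - ξ|) * (y / (Real.pi * Real.sqrt (Q ^ 2 - y ^ 2))) = ξ := by
  rintro ξ ⟨hξ, hξQ⟩
  obtain ⟨i₁, e₁⟩ := integral_log_mul_eq_sub hξ hξQ le_rfl hξ.le hξQ.le fun y hy => hy.2.ne
  obtain ⟨i₂, e₂⟩ := integral_log_mul_eq_sub hξ hξQ hξ.le hξQ.le le_rfl fun y hy => hy.1.ne'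
  have hfun : (fun y => Real.log ((y + ξ) / |y - ξ|) *
        (y / (Real.pi * Real.sqrt (Q ^ 2 - y ^ 2)))) =
      fun y => Real.pi⁻¹ * (Real.log ((y + ξ) / |y - ξ|) * (y / √(Q ^ 2 - y ^ 2))) := by
    funext y
    rw [mul_comm Real.pi, ← div_div]
    ring
  rw [hfun]
  refine ⟨(i₁.trans i₂).const_mul _, ?_⟩
  rw [intervalIntegral.integral_const_mul, ← intervalIntegral.integral_add_adjacent_intervals i₁ i₂,
    e₁, e₂, condensatePrimitive_zero hξ hξQ, condensatePrimitive_self hξ hξQ]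
  have := Real.pi_ne_zero
  field_simp
  ring
end
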